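/- (Type D case.) Let t, p ≥ 0 and let Λ = (A,B) and Ξ = (A',B') be β-pairs of defect 4t as in the context. Then, computing b(Λ⊕Ξ) with the 𝕏-reference sequence, one has a(Λ) + a(Ξ) ≤ b(Λ⊕Ξ); moreover equality holds if and only if for every 1 ≤ i ≤ p+4t and every 1 ≤ j ≤ p, either (a_i ≤ b_j and a_i' ≤ b_j') or (a_i ≥ b_j and a_i' ≥ b_j'). -/

import Mathlib

namespace CSpaper

/-- The rank of a β-set: the sum of its elements minus `choose (card) 2`. -/
def bRank (B : Finset ℕ) : ℤ :=
  (∑ b ∈ B, (b : ℤ)) - (B.card.choose 2 : ℤ)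

/-- The `k`-th shift of a β-set: `{0,…,k-1} ∪ {b+k : b ∈ B}`. -/
def bShift (k : ℕ) (B : Finset ℕ) : Finset ℕ :=
  Finset.range k ∪ B.image (· + k)

/-- Shift-equivalence of β-sets. -/
def sEquiv (A B : Finset ℕ) : Prop :=
  ∃ k, bShift k A = B ∨ A = bShift k B

/-- A β-pair: an ordered pair of β-sets. -/
abbrev BPair := Finset ℕ × Finset ℕ

/-- The defect of a β-pair. -/
def pDefect (Λ : BPair) : ℤ := (Λ.1.card : ℤ) - (Λ.2.card : ℤ)

/-- The rank of a β-pair: `rk A + rk B + ⌊(d/2)²⌋`. -/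
def pRank (Λ : BPair) : ℤ := bRank Λ.1 + bRank Λ.2 + pDefect Λ ^ 2 / 4

/-- The `k`-th shift of a β-pair. -/
def pShift (k : ℕ) (Λ : BPair) : BPair := (bShift k Λ.1, bShift k Λ.2)

/-- Shift-equivalence of β-pairs: one is a shift of the other. -/
def pEquiv (Λ Ξ : BPair) : Prop := ∃ k, pShift k Λ = Ξ ∨ Λ = pShift k Ξ

/-- `Λ` is a representative of a symbol in `𝕍_N^d`. -/
def inV (N d : ℤ) (Λ : BPair) : Prop := pRank Λ = N ∧ pDefect Λ = d

/-- The `i`-th smallest element of a finite set of naturals (0-indexed). -/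
def nthEl (A : Finset ℕ) (i : ℕ) : ℕ := (A.sort (· ≤ ·)).getD i 0

/-- The operation `A ⊙ B = {a_1+b_1, a_2+b_2-1, …, a_s+b_s-(s-1)}` (0-indexed:
`a_i + b_i - i`). -/
def odot (A B : Finset ℕ) : Finset ℕ :=
  (Finset.range A.card).image fun i => nthEl A i + nthEl B i - i

/-- Dominance order `B ⊴ A`: every tail sum of `B` is at most the corresponding
tail sum of `A`. -/
def domLE (B A : Finset ℕ) : Prop :=
  ∀ k, ∑ i ∈ Finset.Ico k B.card, nthEl B i ≤ ∑ i ∈ Finset.Ico k A.card, nthEl A i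

/-- No two consecutive integers. -/
def noConsec (S : Finset ℕ) : Prop := ∀ x ∈ S, x + 1 ∉ S

/-- `{0,2,…,2k-2} ∪ {x+2k : x ∈ S}`. -/
def evShift (k : ℕ) (S : Finset ℕ) : Finset ℕ :=
  (Finset.range k).image (fun i => 2 * i) ∪ S.image (· + 2 * k)

/-- `{1,3,…,2k-1} ∪ {y+2k : y ∈ S}`. -/
def odShift (k : ℕ) (S : Finset ℕ) : Finset ℕ :=
  (Finset.range k).image (fun i => 2 * i + 1) ∪ S.image (· + 2 * k)

/-- The `k`-th shift in the 𝕐-family. -/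
def yShift (k : ℕ) (P : BPair) : BPair := (evShift k P.1, odShift k P.2)

/-- The `k`-th shift in the 𝕏-family. -/
def xShift (k : ℕ) (P : BPair) : BPair := (evShift k P.1, evShift k P.2)

/-- Shift-equivalence in the 𝕐-family. -/
def yEquiv (P Q : BPair) : Prop := ∃ k, yShift k P = Q ∨ P = yShift k Q

/-- Shift-equivalence in the 𝕏-family (unordered pairs, so swaps are allowed). -/
def xEquiv (P Q : BPair) : Prop :=
  ∃ k, xShift k P = Q ∨ xShift k P = Q.swap ∨ P = xShift k Q ∨ P.swap = xShift k Q

/-- Membership in `Ỹ_N`. -/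
def inYtilde (N : ℤ) (P : BPair) : Prop :=
  (∀ y ∈ P.2, 0 < y) ∧ Odd (P.1.card + P.2.card) ∧ noConsec P.1 ∧ noConsec P.2 ∧
    2 * ((∑ x ∈ P.1, (x : ℤ)) + ∑ y ∈ P.2, (y : ℤ)) =
      N + ((P.1.card + P.2.card : ℕ) : ℤ) * (((P.1.card + P.2.card : ℕ) : ℤ) - 1)

/-- The defect in the 𝕐-family: `|X| - |Y|`. -/
def yDefect (P : BPair) : ℤ := (P.1.card : ℤ) - (P.2.card : ℤ)

/-- Membership in `X̃_N`. -/
def inXtilde (N : ℤ) (P : BPair) : Prop :=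
  noConsec P.1 ∧ noConsec P.2 ∧
    2 * ((∑ x ∈ P.1, (x : ℤ)) + ∑ y ∈ P.2, (y : ℤ)) =
      N + (((P.1.card + P.2.card : ℕ) : ℤ) - 1) ^ 2 - 1

/-- The defect in the 𝕏-family: `||A| - |B||`. -/
def xDefect (P : BPair) : ℤ := |(P.1.card : ℤ) - (P.2.card : ℤ)|

/-- The map `Θ(A,B) = ({0, a_1+2, …, a_s+s+1}, {b_1+1, …, b_s+s})`. -/
def theta (Λ : BPair) : BPair :=
  (insert 0 ((Finset.range Λ.1.card).image fun i => nthEl Λ.1 i + i + 2),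
   (Finset.range Λ.2.card).image fun i => nthEl Λ.2 i + i + 1)

/-- The map `Θ'(A,B) = ({0, a_1+2, …, a_s+s+1}, {b_1, …, b_s+s-1})`. -/
def theta' (Λ : BPair) : BPair :=
  (insert 0 ((Finset.range Λ.1.card).image fun i => nthEl Λ.1 i + i + 2),
   (Finset.range Λ.2.card).image fun i => nthEl Λ.2 i + i)

/-- The map `Θ̄(A,B) = ({a_1, …, a_s+s-1}, {b_1, …, b_s+s-1})`. -/
def thetaBar (Λ : BPair) : BPair :=
  ((Finset.range Λ.1.card).image fun i => nthEl Λ.1 i + i,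
   (Finset.range Λ.2.card).image fun i => nthEl Λ.2 i + i)

/-- `ᵀΘ(A,B) = Θ(B,A)`. -/
def thetaT (Λ : BPair) : BPair := theta (Λ.2, Λ.1)

/-- `Π^d` for `d ≥ 1`: adjoin `{0,2,…,2d-4}` to the first row and add `2d-2`
to its entries. -/
def piPos (d : ℕ) (P : BPair) : BPair := (evShift (d - 1) P.1, P.2)

/-- `Π^d` for `d = -e ≤ -1`: adjoin `{1,3,…,2e+1}` to the second row and add
`2e+2` to its entries. -/
def piNeg (e : ℕ) (P : BPair) : BPair := (P.1, odShift (e + 1) P.2)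

/-- `Δ_B^t = Π^{2t+1} ∘ Θ'`. -/
def deltaB (t : ℕ) (Λ : BPair) : BPair := piPos (2 * t + 1) (theta' Λ)

/-- `Δ_C^t = Π^{4t+1} ∘ Θ`. -/
def deltaC (t : ℕ) (Λ : BPair) : BPair := piPos (4 * t + 1) (theta Λ)

/-- `Δ_{C'}^t = Π^{1-4t} ∘ ᵀΘ` (for `t ≥ 1`). -/
def deltaC' (t : ℕ) (Λ : BPair) : BPair := piNeg (4 * t - 1) (thetaT Λ)

/-- `Δ_D^t = Π^{4t} ∘ Θ'` (for `t ≥ 1`). -/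
def deltaD (t : ℕ) (Λ : BPair) : BPair := piPos (4 * t) (theta' Λ)

/-- `Δ_D^0 = Θ̄`. -/
def deltaD0 (Λ : BPair) : BPair := thetaBar Λ

/-- All entries of a pair (with multiplicity) in weakly increasing order. -/
def entries (P : BPair) : List ℕ := (P.1.val + P.2.val).sort (· ≤ ·)

/-- `Σ_j (len-1-j) ⬝ (L[j] - ref j)`, the common shape of `a`, `b` and `σ`. -/
def wsum (L : List ℕ) (ref : ℕ → ℕ) : ℤ :=
  ∑ j ∈ Finset.range L.length,
    ((L.length - 1 - j : ℕ) : ℤ) * ((L.getD j 0 : ℤ) - (ref j : ℤ))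

/-- Lusztig's a-function (reference sequence `0,0,1,1,…`). -/
def aFun (P : BPair) : ℤ := wsum (entries P) (fun j => j / 2)

/-- Lusztig's b-function with the 𝕏-reference sequence `0,0,2,2,…`. -/
def bX (P : BPair) : ℤ := wsum (entries P) (fun j => 2 * (j / 2))

/-- Lusztig's b-function with the 𝕐-reference sequence `0,1,2,…`. -/
def bY (P : BPair) : ℤ := wsum (entries P) (fun j => j)

/-- `σ(Λ) = Σ (2k-i)·x_i`. -/
def sigmaFun (P : BPair) : ℤ := wsum (entries P) (fun _ => 0)

/-- Entrywise sum of two rows (of equal size), sorted positions added. -/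
def addRows (X X' : Finset ℕ) : Finset ℕ :=
  (Finset.range X.card).image fun i => nthEl X i + nthEl X' i

/-- `Λ ⊕ Ξ` in the types B and D cases. -/
def oplus (Λ Ξ : BPair) : BPair := (addRows Λ.1 Ξ.1, addRows Λ.2 Ξ.2)

/-- `Λ ⊕ Ξ` in the type C case. -/
def oplusC (Λ Ξ : BPair) : BPair :=
  (insert (nthEl Ξ.1 0)
      ((Finset.range Λ.1.card).image fun i => nthEl Λ.1 i + nthEl Ξ.1 (i + 1) + 1),
   (Finset.range Λ.2.card).image fun j => nthEl Λ.2 j + nthEl Ξ.2 j + 1)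

/-- `Λ ⊞ Ξ`: the twisted combination in type D. -/
def boxplus (Λ Ξ : BPair) : BPair := (addRows Λ.2 Ξ.1, addRows Λ.1 Ξ.2)

/-- Similarity of β-pairs: after shifts, the row unions and row intersections
coincide. -/
def pSimilar (Λ Ξ : BPair) : Prop :=
  ∃ j k, (pShift j Λ).1 ∪ (pShift j Λ).2 = (pShift k Ξ).1 ∪ (pShift k Ξ).2 ∧
    (pShift j Λ).1 ∩ (pShift j Λ).2 = (pShift k Ξ).1 ∩ (pShift k Ξ).2

/-- Similarity in the 𝕏-family: after 𝕏-shifts, the row unions and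
intersections coincide. -/
def xSimilar (P Q : BPair) : Prop :=
  ∃ j k, (xShift j P).1 ∪ (xShift j P).2 = (xShift k Q).1 ∪ (xShift k Q).2 ∧
    (xShift j P).1 ∩ (xShift j P).2 = (xShift k Q).1 ∩ (xShift k Q).2

/-- A β-pair is reduced if it is not a proper shift, i.e. `0` does not lie in
both rows; each shift-equivalence class has a unique reduced representative. -/
def reduced (Λ : BPair) : Prop := ¬ (0 ∈ Λ.1 ∧ 0 ∈ Λ.2)

/-- `a(Λ) + a(Ξ) = b(Λ⊕Ξ)`, computed (as in the paper) on shift-representatives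
with matching row sizes. -/
def minimalPair (Λ Ξ : BPair) : Prop :=
  ∃ Λ' Ξ', pEquiv Λ Λ' ∧ pEquiv Ξ Ξ' ∧ Λ'.1.card = Ξ'.1.card ∧
    Λ'.2.card = Ξ'.2.card ∧ aFun Λ' + aFun Ξ' = bX (oplus Λ' Ξ')

/-- The generating relation `i ≈ i+1` whenever `c_i = c_{i+1}` or `d_i = d_{i+1}`. -/
def linkRel (n : ℕ) (c d : ℕ → ℕ) (i j : Fin n) : Prop :=
  (j : ℕ) = (i : ℕ) + 1 ∧ (c i = c j ∨ d i = d j)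

/-- The equivalence relation generated by `linkRel`. -/
def idxSetoid (n : ℕ) (c d : ℕ → ℕ) : Setoid (Fin n) :=
  ⟨Relation.EqvGen (linkRel n c d), Relation.EqvGen.is_equivalence _⟩

/-- A degenerate equivalence class: `{i, i+1}` with `c_i = c_{i+1}` and
`d_i = d_{i+1}`. -/
def degenClass (n : ℕ) (c d : ℕ → ℕ) (Q : Quotient (idxSetoid n c d)) : Prop :=
  ∃ i j : Fin n, (j : ℕ) = (i : ℕ) + 1 ∧ c i = c j ∧ d i = d j ∧
    Q = Quotient.mk (idxSetoid n c d) i ∧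
    ∀ m : Fin n, Quotient.mk (idxSetoid n c d) m = Q → m = i ∨ m = j

/-- The number `ℓ` of non-degenerate equivalence classes. -/
noncomputable def ellCount (n : ℕ) (c d : ℕ → ℕ) : ℕ :=
  Nat.card {Q : Quotient (idxSetoid n c d) // ¬ degenClass n c d Q}

/-- `Ξ` is obtained from `Λ` by decreasing a single entry by `1`, the result
again being a β-pair. -/
def stepDown (Λ Ξ : BPair) : Prop :=
  (∃ x ∈ Λ.1, 0 < x ∧ x - 1 ∉ Λ.1 ∧ Ξ = (insert (x - 1) (Λ.1.erase x), Λ.2)) ∨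
  (∃ x ∈ Λ.2, 0 < x ∧ x - 1 ∉ Λ.2 ∧ Ξ = (Λ.1, insert (x - 1) (Λ.2.erase x)))

/-- For a weakly increasing list, the position-weighted sum counts the minima over all pairs. -/
theorem two_mul_weighted_sum_add_sum (L : List ℕ) (hL : L.Pairwise (· ≤ ·)) :
    2 * ∑ j ∈ Finset.range L.length, ((L.length - 1 - j : ℕ) : ℤ) * (L.getD j 0 : ℤ)
        + (L.map fun x : ℕ => (x : ℤ)).sum =
      (L.map fun x => (L.map fun y => ((min x y : ℕ) : ℤ)).sum).sum := by
  induction L with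
  | nil => simp
  | cons a L ih =>
    obtain ⟨ha, hL⟩ := List.pairwise_cons.1 hL
    have hl : (L.map fun y => ((min a y : ℕ) : ℤ)).sum = L.length * (a : ℤ) := by
      rw [List.map_congr_left (g := fun _ => (a : ℤ))
        (fun y hy => by rw [min_eq_left (ha y hy)])]
      simp
    have hr : (L.map fun x => ((min x a : ℕ) : ℤ)).sum = L.length * (a : ℤ) := by
      simpa only [min_comm] using hl
    have key : ∑ j ∈ Finset.range (a :: L).length,
          (((a :: L).length - 1 - j : ℕ) : ℤ) * ((a :: L).getD j 0 : ℤ) =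
        L.length * (a : ℤ) +
          ∑ j ∈ Finset.range L.length, ((L.length - 1 - j : ℕ) : ℤ) * (L.getD j 0 : ℤ) := by
      rw [List.length_cons, Finset.sum_range_succ', add_comm]
      congr 1
      refine Finset.sum_congr rfl fun j _ => ?_
      rw [List.getD_cons_succ, show L.length + 1 - 1 - (j + 1) = L.length - 1 - j by omega]
    rw [key]
    simp only [List.map_cons, List.sum_cons, List.sum_map_add, min_self]
    rw [hl, hr, ← ih hL]
    ring

/-- The reference-free weighted sum of a pair, in terms of pairwise minima. -/
theorem two_mul_sigmaFun_add_sum (P : BPair) :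
    2 * sigmaFun P + (∑ x ∈ P.1, (x : ℤ) + ∑ y ∈ P.2, (y : ℤ)) =
      ∑ x ∈ P.1, ∑ y ∈ P.1, ((min x y : ℕ) : ℤ) + ∑ x ∈ P.2, ∑ y ∈ P.2, ((min x y : ℕ) : ℤ)
        + 2 * ∑ x ∈ P.1, ∑ y ∈ P.2, ((min x y : ℕ) : ℤ) := by
  have hs : (entries P : Multiset ℕ) = P.1.val + P.2.val := Multiset.sort_eq _ _
  have hf (f : ℕ → ℤ) : ((entries P).map f).sum = ∑ x ∈ P.1, f x + ∑ y ∈ P.2, f y := by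
    rw [← Multiset.sum_coe, ← Multiset.map_coe, hs, Multiset.map_add, Multiset.sum_add]
    rfl
  have h := two_mul_weighted_sum_add_sum (entries P) (Multiset.pairwise_sort _ _)
  simp only [hf, Finset.sum_add_distrib] at h
  have hc : ∑ x ∈ P.2, ∑ y ∈ P.1, ((min x y : ℕ) : ℤ) =
      ∑ x ∈ P.1, ∑ y ∈ P.2, ((min x y : ℕ) : ℤ) := by
    rw [Finset.sum_comm]
    simp only [min_comm]
  rw [hc] at h
  simp only [sigmaFun, wsum, Nat.cast_zero, sub_zero]
  linarith

theorem wsum_eq_sub (L : List ℕ) (ref : ℕ → ℕ) :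
    wsum L ref = wsum L (fun _ => 0) -
      ∑ j ∈ Finset.range L.length, ((L.length - 1 - j : ℕ) : ℤ) * (ref j : ℤ) := by
  simp only [wsum, ← Finset.sum_sub_distrib]
  exact Finset.sum_congr rfl fun j _ => by push_cast; ring

theorem length_entries (P : BPair) : (entries P).length = P.1.card + P.2.card := by
  simp [entries]

theorem nthEl_eq_orderEmbOfFin {A : Finset ℕ} {n : ℕ} (h : A.card = n) (i : Fin n) :
    nthEl A i = A.orderEmbOfFin h i := by
  rw [nthEl, Finset.orderEmbOfFin_apply, List.getD_eq_getElem]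
  rfl

theorem nthEl_lt_nthEl {A : Finset ℕ} {i j : ℕ} (hij : i < j) (hj : j < A.card) :
    nthEl A i < nthEl A j := by
  rw [nthEl_eq_orderEmbOfFin rfl ⟨i, hij.trans hj⟩, nthEl_eq_orderEmbOfFin rfl ⟨j, hj⟩]
  exact (A.orderEmbOfFin rfl).strictMono hij

theorem nthEl_le_nthEl {A : Finset ℕ} {i j : ℕ} (hij : i ≤ j) (hj : j < A.card) :
    nthEl A i ≤ nthEl A j := by
  rcases hij.eq_or_lt with rfl | h
  · exact le_rfl
  · exact (nthEl_lt_nthEl h hj).le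

theorem injOn_nthEl (A : Finset ℕ) : Set.InjOn (nthEl A) (Finset.range A.card) :=
  StrictMonoOn.injOn fun _ _ _ hj hij => nthEl_lt_nthEl hij (Finset.mem_range.1 hj)

theorem injOn_nthEl_add {A A' : Finset ℕ} (h : A'.card = A.card) :
    Set.InjOn (fun i => nthEl A i + nthEl A' i) (Finset.range A.card) := by
  refine StrictMonoOn.injOn fun _ _ _ hj hij => ?_
  have hj := Finset.mem_range.1 hj
  exact add_lt_add (nthEl_lt_nthEl hij hj) (nthEl_lt_nthEl hij (h ▸ hj))

theorem image_nthEl (A : Finset ℕ) : (Finset.range A.card).image (nthEl A) = A := by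
  apply Finset.eq_of_subset_of_card_le
  · intro x hx
    obtain ⟨i, hi, rfl⟩ := Finset.mem_image.1 hx
    rw [nthEl_eq_orderEmbOfFin rfl ⟨i, Finset.mem_range.1 hi⟩]
    exact Finset.orderEmbOfFin_mem _ _ _
  · rw [Finset.card_image_of_injOn (injOn_nthEl A), Finset.card_range]

theorem sum_eq_sum_range_nthEl {A : Finset ℕ} {n : ℕ} (h : A.card = n) (f : ℕ → ℤ) :
    ∑ x ∈ A, f x = ∑ i ∈ Finset.range n, f (nthEl A i) := by
  subst h
  conv_lhs => rw [← image_nthEl A]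
  exact Finset.sum_image (injOn_nthEl A)

theorem sum_addRows {A A' : Finset ℕ} {n : ℕ} (h : A.card = n) (h' : A'.card = n) (f : ℕ → ℤ) :
    ∑ x ∈ addRows A A', f x = ∑ i ∈ Finset.range n, f (nthEl A i + nthEl A' i) := by
  subst h
  exact Finset.sum_image (injOn_nthEl_add h')

theorem card_addRows {A A' : Finset ℕ} (h : A'.card = A.card) :
    (addRows A A').card = A.card := by
  rw [addRows, Finset.card_image_of_injOn (injOn_nthEl_add h), Finset.card_range]

/-- Within a row the pairwise minima are additive, since both rows are listed in order. -/
theorem sum_min_addRows {A A' : Finset ℕ} {n : ℕ} (h : A.card = n) (h' : A'.card = n) :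
    ∑ x ∈ addRows A A', ∑ y ∈ addRows A A', ((min x y : ℕ) : ℤ) =
      ∑ x ∈ A, ∑ y ∈ A, ((min x y : ℕ) : ℤ) + ∑ x ∈ A', ∑ y ∈ A', ((min x y : ℕ) : ℤ) := by
  simp only [sum_addRows h h', sum_eq_sum_range_nthEl h, sum_eq_sum_range_nthEl h',
    ← Finset.sum_add_distrib]
  refine Finset.sum_congr rfl fun i hi => Finset.sum_congr rfl fun j hj => ?_
  rw [Finset.mem_range] at hi hj
  rcases le_total i j with hij | hij
  · have := nthEl_le_nthEl hij (h ▸ hj)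
    have := nthEl_le_nthEl hij (h' ▸ hj)
    omega
  · have := nthEl_le_nthEl hij (h ▸ hi)
    have := nthEl_le_nthEl hij (h' ▸ hi)
    omega

theorem sigmaFun_oplus_sub {A B A' B' : Finset ℕ} {m n : ℕ}
    (hA : A.card = m) (hB : B.card = n) (hA' : A'.card = m) (hB' : B'.card = n) :
    sigmaFun (oplus (A, B) (A', B')) - sigmaFun (A, B) - sigmaFun (A', B') =
      ∑ i ∈ Finset.range m, ∑ j ∈ Finset.range n,
        (((min (nthEl A i + nthEl A' i) (nthEl B j + nthEl B' j) : ℕ) : ℤ)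
          - (min (nthEl A i) (nthEl B j) : ℕ) - (min (nthEl A' i) (nthEl B' j) : ℕ)) := by
  have h₀ := two_mul_sigmaFun_add_sum (oplus (A, B) (A', B'))
  have h₁ := two_mul_sigmaFun_add_sum (A, B)
  have h₂ := two_mul_sigmaFun_add_sum (A', B')
  have hsum {X X' : Finset ℕ} {k : ℕ} (h : X.card = k) (h' : X'.card = k) :
      ∑ x ∈ addRows X X', (x : ℤ) = ∑ x ∈ X, (x : ℤ) + ∑ x ∈ X', (x : ℤ) := by
    simp only [sum_addRows h h', sum_eq_sum_range_nthEl h, sum_eq_sum_range_nthEl h',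
      ← Finset.sum_add_distrib, Nat.cast_add]
  simp only [oplus] at h₀ h₁ h₂ ⊢
  rw [sum_min_addRows hA hA', sum_min_addRows hB hB', hsum hA hA', hsum hB hB'] at h₀
  have hcross : ∑ x ∈ addRows A A', ∑ y ∈ addRows B B', ((min x y : ℕ) : ℤ) =
      ∑ i ∈ Finset.range m, ∑ j ∈ Finset.range n,
        ((min (nthEl A i + nthEl A' i) (nthEl B j + nthEl B' j) : ℕ) : ℤ) := by
    simp only [sum_addRows hA hA', sum_addRows hB hB']
  have hcross₁ : ∑ x ∈ A, ∑ y ∈ B, ((min x y : ℕ) : ℤ) =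
      ∑ i ∈ Finset.range m, ∑ j ∈ Finset.range n, ((min (nthEl A i) (nthEl B j) : ℕ) : ℤ) := by
    simp only [sum_eq_sum_range_nthEl hA, sum_eq_sum_range_nthEl hB]
  have hcross₂ : ∑ x ∈ A', ∑ y ∈ B', ((min x y : ℕ) : ℤ) =
      ∑ i ∈ Finset.range m, ∑ j ∈ Finset.range n,
        ((min (nthEl A' i) (nthEl B' j) : ℕ) : ℤ) := by
    simp only [sum_eq_sum_range_nthEl hA', sum_eq_sum_range_nthEl hB']
  simp only [Finset.sum_sub_distrib, ← hcross, ← hcross₁, ← hcross₂]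
  linarith

/-- The reference sequences of `a` (twice) and `b` cancel. -/
theorem bX_oplus_sub {A B A' B' : Finset ℕ} (hA : A'.card = A.card) (hB : B'.card = B.card) :
    bX (oplus (A, B) (A', B')) - (aFun (A, B) + aFun (A', B')) =
      sigmaFun (oplus (A, B) (A', B')) - sigmaFun (A, B) - sigmaFun (A', B') := by
  rw [bX, aFun, aFun, wsum_eq_sub _ (fun j => 2 * (j / 2)), wsum_eq_sub _ (fun j => j / 2),
    wsum_eq_sub (entries (A', B')) (fun j => j / 2)]
  simp only [length_entries, oplus, card_addRows hA, card_addRows hB, hA, hB, sigmaFun,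
    Nat.cast_mul, Nat.cast_ofNat, mul_left_comm _ (2 : ℤ), ← Finset.mul_sum]
  ring

/-- type D: `a(Λ) + a(Ξ) ≤ b(Λ⊕Ξ)` with the 𝕏-reference
sequence, with equality iff for all `i`, `j` either `a_i ≤ b_j ∧ a_i' ≤ b_j'`
or `a_i ≥ b_j ∧ a_i' ≥ b_j'`. -/
theorem statement_13 (t p : ℕ) (A B A' B' : Finset ℕ)
    (hA : A.card = p + 4 * t) (hB : B.card = p)
    (hA' : A'.card = p + 4 * t) (hB' : B'.card = p) :
    aFun (A, B) + aFun (A', B') ≤ bX (oplus (A, B) (A', B')) ∧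
    (aFun (A, B) + aFun (A', B') = bX (oplus (A, B) (A', B')) ↔
      ∀ i < p + 4 * t, ∀ j < p,
        (nthEl A i ≤ nthEl B j ∧ nthEl A' i ≤ nthEl B' j) ∨
        (nthEl B j ≤ nthEl A i ∧ nthEl B' j ≤ nthEl A' i)) := by
  have hdiff := (bX_oplus_sub (hA'.trans hA.symm) (hB'.trans hB.symm)).trans
    (sigmaFun_oplus_sub hA hB hA' hB')
  have hnonneg (i j : ℕ) :
      0 ≤ (((min (nthEl A i + nthEl A' i) (nthEl B j + nthEl B' j) : ℕ) : ℤ)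
          - (min (nthEl A i) (nthEl B j) : ℕ) - (min (nthEl A' i) (nthEl B' j) : ℕ)) := by
    omega
  refine ⟨sub_nonneg.1 (hdiff ▸ Finset.sum_nonneg fun i _ =>
    Finset.sum_nonneg fun j _ => hnonneg i j), ?_⟩
  rw [eq_comm, ← sub_eq_zero, hdiff, Finset.sum_eq_zero_iff_of_nonneg
    fun i _ => Finset.sum_nonneg fun j _ => hnonneg i j]
  refine forall_congr' fun i => ?_
  rw [Finset.mem_range, Finset.sum_eq_zero_iff_of_nonneg fun j _ => hnonneg i j]
  refine imp_congr_right fun _ => forall_congr' fun j => ?_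
  rw [Finset.mem_range]
  refine imp_congr_right fun _ => ?_
  omega

end CSpaper
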